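/- Two finite groups G and H have the same character table (i.e., there are bijections between their irreducible complex characters and between their conjugacy classes making the tables of values equal) if and only if there is an algebra isomorphism φ : Z(ℂG) → Z(ℂH) inducing a bijection between the class sums of G and the class sums of H. -/

import Mathlib

open scoped Classical

/-- The class sum of the conjugacy class of `x` in the group algebra `ℂ[G]`. -/
noncomputable def classSum (G : Type) [Group G] [Fintype G] (x : G) : MonoidAlgebra ℂ G :=
  ∑ g : G, if IsConj x g then MonoidAlgebra.single g (1 : ℂ) else 0

set_option linter.unusedSectionVars false

namespace CT

open CategoryTheory

variable {G : Type} [Group G] [Fintype G]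

/-- size of the class -/
noncomputable def ksz (x : G) : ℕ := (Finset.univ.filter (fun g => IsConj x g)).card

lemma ksz_pos (x : G) : 0 < ksz x :=
  Finset.card_pos.mpr ⟨x, by simpa using IsConj.refl x⟩

lemma ksz_congr {x y : G} (h : IsConj x y) : ksz x = ksz y := by
  unfold ksz
  congr 1
  ext g
  simp only [Finset.mem_filter, Finset.mem_univ, true_and]
  exact ⟨fun h' => h.symm.trans h', fun h' => h.trans h'⟩

lemma isConj_inv {x y : G} (h : IsConj x y) : IsConj x⁻¹ y⁻¹ := by
  rw [isConj_iff] at *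
  obtain ⟨c, rfl⟩ := h
  exact ⟨c, by group⟩

lemma ksz_inv (x : G) : ksz x⁻¹ = ksz x := by
  unfold ksz
  apply Finset.card_bij (fun g _ => g⁻¹)
  · intro a ha
    simp only [Finset.mem_filter, Finset.mem_univ, true_and] at *
    simpa using isConj_inv ha
  · intro a _ b _ h
    simpa using h
  · intro b hb
    simp only [Finset.mem_filter, Finset.mem_univ, true_and] at *
    exact ⟨b⁻¹, isConj_inv hb, by simp⟩

lemma ksz_one : ksz (1 : G) = 1 := by
  unfold ksz
  rw [Finset.card_eq_one]
  exact ⟨1, by ext g; simp [eq_comm]⟩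

lemma coeff_classSum (x g : G) : (classSum G x).coeff g = if IsConj x g then 1 else 0 := by
  unfold classSum
  rw [MonoidAlgebra.coeff_sum, Finsupp.finsetSum_apply, Finset.sum_eq_single g]
  · split_ifs <;> simp
  · intro b _ hb
    split_ifs <;> simp [hb]
  · simp

lemma coeff_cs_pos {x g : G} (h : IsConj x g) : (classSum G x).coeff g = 1 := by
  rw [coeff_classSum, if_pos h]

lemma coeff_cs_neg {x g : G} (h : ¬ IsConj x g) : (classSum G x).coeff g = 0 := by
  rw [coeff_classSum, if_neg h]

lemma mem_center_iff' (z : MonoidAlgebra ℂ G) :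
    z ∈ Subalgebra.center ℂ (MonoidAlgebra ℂ G) ↔ ∀ g h, IsConj g h → z.coeff g = z.coeff h := by
  rw [Subalgebra.mem_center_iff]
  constructor
  · intro hz g h hgh
    obtain ⟨c, rfl⟩ := isConj_iff.mp hgh
    have := congrArg (fun w => w.coeff (c * g)) (hz (MonoidAlgebra.single c 1))
    simpa [MonoidAlgebra.coeff_mul_single_apply, MonoidAlgebra.coeff_single_mul_apply] using this
  · intro hz b
    induction b using MonoidAlgebra.induction_linear with
    | zero => simp
    | add f g hf hg => rw [add_mul, mul_add, hf, hg]
    | single a r =>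
      ext g
      rw [MonoidAlgebra.coeff_mul_single_apply, MonoidAlgebra.coeff_single_mul_apply, mul_comm]
      congr 1
      apply hz
      rw [isConj_iff]
      exact ⟨a, by group⟩

lemma classSum_mem (x : G) : classSum G x ∈ Subalgebra.center ℂ (MonoidAlgebra ℂ G) := by
  rw [mem_center_iff']
  intro g h hgh
  rw [coeff_classSum, coeff_classSum]
  congr 1
  exact propext ⟨fun h' => h'.trans hgh, fun h' => h'.trans hgh.symm⟩

lemma schur (V : FDRep ℂ G) [Simple V] (f : V →ₗ[ℂ] V)
    (hf : ∀ g, f ∘ₗ V.ρ g = V.ρ g ∘ₗ f) : ∃ c : ℂ, f = c • LinearMap.id := by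
  have h1 : Module.finrank ℂ (Representation.linHom V.ρ V.ρ).invariants = 1 := by
    rw [LinearEquiv.finrank_eq (Representation.linHom.invariantsEquivFDRepHom V V),
      FDRep.finrank_hom_simple_simple, if_pos ⟨Iso.refl _⟩]
  have hmem : ∀ f : V →ₗ[ℂ] V, (∀ g, f ∘ₗ V.ρ g = V.ρ g ∘ₗ f) →
      f ∈ (Representation.linHom V.ρ V.ρ).invariants := by
    intro f hf g
    rw [Representation.linHom_apply, hf, ← LinearMap.comp_assoc,
      ← Module.End.mul_eq_comp (V.ρ g), ← map_mul, mul_inv_cancel, map_one]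
    rfl
  have hid : (⟨LinearMap.id, hmem _ (fun g => rfl)⟩ :
      (Representation.linHom V.ρ V.ρ).invariants) ≠ 0 := by
    intro h0
    have hz : (LinearMap.id : V →ₗ[ℂ] V) = 0 := congrArg Subtype.val h0
    have : Subsingleton (Representation.linHom V.ρ V.ρ).invariants := by
      constructor
      intro a b
      apply Subtype.ext
      rw [← LinearMap.id_comp a.1, ← LinearMap.id_comp b.1, hz, LinearMap.zero_comp,
        LinearMap.zero_comp]
    rw [Module.finrank_zero_of_subsingleton] at h1
    exact zero_ne_one h1
  obtain ⟨c, hc⟩ := (finrank_eq_one_iff_of_nonzero' _ hid).mp h1 ⟨f, hmem f hf⟩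
  exact ⟨c, (congrArg Subtype.val hc).symm⟩

lemma finrank_pos (V : FDRep ℂ G) [Simple V] : 0 < Module.finrank ℂ V := by
  rw [Module.finrank_pos_iff]
  by_contra hV
  rw [not_nontrivial_iff_subsingleton] at hV
  have h1 : Module.finrank ℂ (Representation.linHom V.ρ V.ρ).invariants = 1 := by
    rw [LinearEquiv.finrank_eq (Representation.linHom.invariantsEquivFDRepHom V V),
      FDRep.finrank_hom_simple_simple, if_pos ⟨Iso.refl _⟩]
  rw [Module.finrank_zero_of_subsingleton] at h1
  exact zero_ne_one h1

lemma char_norm_le (V : FDRep ℂ G) (g : G) : ‖V.character g‖ ≤ Module.finrank ℂ V := by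
  unfold FDRep.character
  rw [Module.End.trace_eq_sum_roots_charpoly_of_splits (IsAlgClosed.splits _)]
  refine (norm_multiset_sum_le _).trans ?_
  have hroot : ∀ a ∈ (V.ρ g).charpoly.roots, ‖a‖ = 1 := by
    intro a ha
    have h1 := (Polynomial.mem_roots'.mp ha).2
    rw [← Module.End.hasEigenvalue_iff_isRoot_charpoly] at h1
    obtain ⟨v, hv⟩ := h1.exists_hasEigenvector
    have h2 := hv.pow_apply (Fintype.card G)
    rw [← map_pow, pow_card_eq_one, map_one, Module.End.one_apply] at h2
    have h3 : a ^ Fintype.card G = 1 := by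
      have : (a ^ Fintype.card G - 1) • v = 0 := by rw [sub_smul, ← h2, one_smul, sub_self]
      rcases smul_eq_zero.mp this with h | h
      · exact sub_eq_zero.mp h
      · exact absurd h hv.2
    exact Complex.norm_eq_one_of_pow_eq_one h3 Fintype.card_ne_zero
  rw [Multiset.map_congr rfl hroot, Multiset.map_const', Multiset.sum_replicate, nsmul_eq_mul,
    mul_one]
  have := Polynomial.card_roots' (V.ρ g).charpoly
  rw [LinearMap.charpoly_natDegree] at this
  exact_mod_cast this

end CT
namespace CT

open CategoryTheory

variable {G : Type} [Group G] [Fintype G]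

lemma trace_asAlgebraHom (V : FDRep ℂ G) (z : MonoidAlgebra ℂ G) :
    LinearMap.trace ℂ V (Representation.asAlgebraHom V.ρ z) = ∑ g, z.coeff g * V.character g := by
  induction z using MonoidAlgebra.induction_linear with
  | zero => simp
  | add f g hf hg => simp [hf, hg, add_mul, Finset.sum_add_distrib]
  | single a r =>
    rw [Representation.asAlgebraHom_single, map_smul, Finset.sum_eq_single a]
    · simp [FDRep.character]
    · intro b _ hb
      simp [Ne.symm hb]
    · simp

/-- central character -/
noncomputable def omg (V : FDRep ℂ G) (z : MonoidAlgebra ℂ G) : ℂ :=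
  (Module.finrank ℂ V : ℂ)⁻¹ * ∑ g, z.coeff g * V.character g

lemma asAlgebraHom_eq (V : FDRep ℂ G) [Simple V] (z : MonoidAlgebra ℂ G)
    (hz : z ∈ Subalgebra.center ℂ (MonoidAlgebra ℂ G)) :
    Representation.asAlgebraHom V.ρ z = omg V z • (1 : Module.End ℂ V) := by
  obtain ⟨c, hc⟩ := schur V (Representation.asAlgebraHom V.ρ z) (fun g => by
    have h := Subalgebra.mem_center_iff.mp hz (MonoidAlgebra.single g 1)
    have h' := congrArg (Representation.asAlgebraHom V.ρ) h
    rw [map_mul, map_mul, Representation.asAlgebraHom_single_one] at h'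
    exact h'.symm)
  have hd : (Module.finrank ℂ V : ℂ) ≠ 0 := by exact_mod_cast (finrank_pos V).ne'
  have : omg V z = c := by
    unfold omg
    rw [← trace_asAlgebraHom, hc, map_smul, LinearMap.trace_id, smul_eq_mul]
    field_simp
  rw [this, hc]
  rfl

lemma smul_one_inj (V : FDRep ℂ G) [Simple V] {a b : ℂ}
    (h : a • (1 : Module.End ℂ V) = b • 1) : a = b := by
  have hd : (Module.finrank ℂ V : ℂ) ≠ 0 := by exact_mod_cast (finrank_pos V).ne'
  have := congrArg (LinearMap.trace ℂ V) h
  rw [map_smul, map_smul, LinearMap.trace_one, smul_eq_mul, smul_eq_mul] at this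
  exact mul_right_cancel₀ hd this

/-- central character as an algebra map -/
noncomputable def omgHom (V : FDRep ℂ G) [Simple V] :
    Subalgebra.center ℂ (MonoidAlgebra ℂ G) →ₐ[ℂ] ℂ where
  toFun z := omg V z
  map_one' := smul_one_inj V (by
    rw [← asAlgebraHom_eq V _ (1 : Subalgebra.center ℂ (MonoidAlgebra ℂ G)).2, OneMemClass.coe_one,
      map_one, one_smul])
  map_mul' a b := smul_one_inj V (by
    rw [← asAlgebraHom_eq V _ (a * b).2]
    simp only [MulMemClass.coe_mul, map_mul]
    rw [asAlgebraHom_eq V _ a.2, asAlgebraHom_eq V _ b.2, smul_mul_smul_comm, one_mul])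
  map_zero' := smul_one_inj V (by
    rw [← asAlgebraHom_eq V _ (0 : Subalgebra.center ℂ (MonoidAlgebra ℂ G)).2,
      ZeroMemClass.coe_zero, map_zero, zero_smul])
  map_add' a b := smul_one_inj V (by
    rw [← asAlgebraHom_eq V _ (a + b).2]
    simp only [AddMemClass.coe_add, map_add]
    rw [asAlgebraHom_eq V _ a.2, asAlgebraHom_eq V _ b.2, add_smul])
  commutes' r := smul_one_inj V (by
    rw [← asAlgebraHom_eq V _ (algebraMap ℂ (Subalgebra.center ℂ (MonoidAlgebra ℂ G)) r).2]
    rw [Subalgebra.coe_algebraMap, AlgHom.commutes, Algebra.algebraMap_eq_smul_one]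
    rfl)

lemma char_congr (V : FDRep ℂ G) {g h : G} (hgh : IsConj g h) : V.character g = V.character h := by
  obtain ⟨c, rfl⟩ := isConj_iff.mp hgh
  rw [FDRep.char_conj]

section table

variable {n : ℕ} {x : Fin n → G} (hdist : ∀ i j, i ≠ j → ¬ IsConj (x i) (x j))
  (hexh : ∀ g : G, ∃ i, IsConj (x i) g)

include hdist hexh

lemma sum_class (f : G → ℂ) (hf : ∀ g h, IsConj g h → f g = f h) :
    ∑ g, f g = ∑ i, (ksz (x i) : ℂ) * f (x i) := by
  have h1 : ∀ g, f g = ∑ i, if IsConj (x i) g then f (x i) else 0 := by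
    intro g
    obtain ⟨i, hi⟩ := hexh g
    rw [Finset.sum_eq_single i, if_pos hi, hf _ _ hi]
    · intro j _ hj
      rw [if_neg]
      exact fun h => hdist j i hj (h.trans hi.symm)
    · simp
  rw [Finset.sum_congr rfl (fun g _ => h1 g), Finset.sum_comm]
  refine Finset.sum_congr rfl fun i _ => ?_
  rw [← Finset.sum_filter, Finset.sum_const, nsmul_eq_mul]
  rfl

lemma eq_sum_classSum (z : MonoidAlgebra ℂ G)
    (hz : z ∈ Subalgebra.center ℂ (MonoidAlgebra ℂ G)) :
    z = ∑ i, z.coeff (x i) • classSum G (x i) := by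
  rw [mem_center_iff'] at hz
  ext g
  obtain ⟨i, hi⟩ := hexh g
  rw [MonoidAlgebra.coeff_sum, Finsupp.finsetSum_apply, Finset.sum_eq_single i]
  · simp [coeff_cs_pos hi, hz _ _ hi]
  · intro j _ hj
    have : ¬ IsConj (x j) g := fun h => hdist j i hj (h.trans hi.symm)
    simp [coeff_cs_neg this]
  · simp

lemma omg_eq (V : FDRep ℂ G) (z : MonoidAlgebra ℂ G)
    (hz : z ∈ Subalgebra.center ℂ (MonoidAlgebra ℂ G)) :
    omg V z = (Module.finrank ℂ V : ℂ)⁻¹ *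
      ∑ i, (ksz (x i) : ℂ) * (z.coeff (x i) * V.character (x i)) := by
  unfold omg
  rw [sum_class hdist hexh]
  intro g h hgh
  rw [char_congr V hgh, (mem_center_iff' z).mp hz g h hgh]

lemma omg_classSum (V : FDRep ℂ G) (i : Fin n) :
    omg V (classSum G (x i)) = (Module.finrank ℂ V : ℂ)⁻¹ * (ksz (x i) * V.character (x i)) := by
  rw [omg_eq hdist hexh V _ (classSum_mem _), Finset.sum_eq_single i]
  · simp [coeff_cs_pos (IsConj.refl (x i))]
  · intro j _ hj
    simp [coeff_cs_neg (hdist i j hj.symm)]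
  · simp

variable {V : Fin n → FDRep ℂ G} [hs : ∀ t, Simple (V t)]
  (hniso : ∀ l m, l ≠ m → ¬ Nonempty (V l ≅ V m))

include hniso

lemma row_orth :
    (Matrix.of fun t i => (V t).character (x i)) *
    (Matrix.of fun i t => (Fintype.card G : ℂ)⁻¹ * (ksz (x i) * (V t).character (x i)⁻¹)) = 1 := by
  ext s t
  have hc : (Nat.card G : ℂ) ≠ 0 := by exact_mod_cast Nat.card_pos.ne'
  have : Invertible (Nat.card G : ℂ) := invertibleOfNonzero hc
  have h := FDRep.char_orthonormal (V s) (V t)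
  have h2 : (if Nonempty (V s ≅ V t) then (1 : ℂ) else 0) = (1 : Matrix (Fin n) (Fin n) ℂ) s t := by
    rw [Matrix.one_apply]
    by_cases hst : s = t
    · subst hst
      rw [if_pos ⟨Iso.refl _⟩, if_pos rfl]
    · rw [if_neg (hniso _ _ hst), if_neg hst]
  rw [← h2, ← h, sum_class hdist hexh, Matrix.mul_apply, Finset.mul_sum, Nat.card_eq_fintype_card]
  · refine Finset.sum_congr rfl fun i _ => ?_
    simp only [Matrix.of_apply]
    ring
  · intro g h hgh
    rw [char_congr (V s) hgh, char_congr (V t) (isConj_inv hgh)]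

lemma col_orth (i j : Fin n) :
    (ksz (x i) : ℂ) * ∑ t, (V t).character (x i)⁻¹ * (V t).character (x j)
      = if i = j then (Fintype.card G : ℂ) else 0 := by
  have h := mul_eq_one_comm.mp (row_orth hdist hexh hniso)
  have h' := congrFun (congrFun h i) j
  have hc : (Fintype.card G : ℂ) ≠ 0 := by exact_mod_cast Fintype.card_ne_zero
  rw [Matrix.mul_apply, Matrix.one_apply] at h'
  simp only [Matrix.of_apply, mul_assoc] at h'
  rw [← Finset.mul_sum, ← Finset.mul_sum] at h'
  rw [inv_mul_eq_iff_eq_mul₀ hc] at h'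
  rw [h']
  simp

/-- columns distinct, class sizes -/
lemma ksz_formula (i : Fin n) :
    (ksz (x i) : ℂ) * ∑ j, ∑ t, (V t).character (x i) * (V t).character (x j)
      = (Fintype.card G : ℂ) := by
  obtain ⟨i', hi'⟩ := hexh (x i)⁻¹
  have h1 : IsConj (x i')⁻¹ (x i) := by simpa using isConj_inv hi'
  have h2 : ksz (x i) = ksz (x i') := by rw [ksz_congr hi', ksz_inv]
  have h3 : ∀ j, ∑ t, (V t).character (x i) * (V t).character (x j) =
      ∑ t, (V t).character (x i')⁻¹ * (V t).character (x j) := fun j =>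
    Finset.sum_congr rfl fun t _ => by rw [char_congr (V t) h1]
  rw [h2, Finset.mul_sum]
  simp_rw [h3, col_orth hdist hexh hniso]
  simp

lemma col_inj {i j : Fin n} (h : ∀ t, (V t).character (x i) = (V t).character (x j)) : i = j := by
  by_contra hij
  have h1 := col_orth hdist hexh hniso i j
  have h2 := col_orth hdist hexh hniso i i
  rw [if_neg hij] at h1
  rw [if_pos rfl] at h2
  simp_rw [h] at h2
  rw [h1] at h2
  have hc : (Fintype.card G : ℂ) ≠ 0 := by exact_mod_cast Fintype.card_ne_zero
  exact hc h2.symm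

lemma coeff_one_formula (z : MonoidAlgebra ℂ G)
    (hz : z ∈ Subalgebra.center ℂ (MonoidAlgebra ℂ G)) :
    (Fintype.card G : ℂ) * z.coeff 1 = ∑ t, (Module.finrank ℂ (V t) : ℂ) ^ 2 * omg (V t) z := by
  obtain ⟨i0, hi0⟩ := hexh 1
  have hx : x i0 = 1 := by simpa using hi0
  have hd : ∀ t, (Module.finrank ℂ (V t) : ℂ) ≠ 0 := fun t => by
    exact_mod_cast (finrank_pos (V t)).ne'
  have h1 : ∀ t, (Module.finrank ℂ (V t) : ℂ) ^ 2 * omg (V t) z =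
      ∑ i, (ksz (x i) * z.coeff (x i)) * ((V t).character (x i0)⁻¹ * (V t).character (x i)) := by
    intro t
    rw [omg_eq hdist hexh _ _ hz, hx, inv_one, FDRep.char_one, pow_two, mul_assoc,
      mul_inv_cancel_left₀ (hd t), Finset.mul_sum]
    refine Finset.sum_congr rfl fun i _ => ?_
    ring
  have h2 : ∀ i, ∑ t, (V t).character (x i0)⁻¹ * (V t).character (x i) =
      if i0 = i then (Fintype.card G : ℂ) else 0 := by
    intro i
    have := col_orth hdist hexh hniso i0 i
    rwa [show ksz (x i0) = 1 by rw [hx, ksz_one], Nat.cast_one, one_mul] at this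
  simp_rw [h1]
  rw [Finset.sum_comm]
  simp_rw [← Finset.mul_sum, h2]
  simp [hx, ksz_one, mul_comm]

/-- the product of the central characters is bijective -/
lemma omg_bij : Function.Bijective
    (AlgHom.pi (fun t : Fin n => omgHom (V t))) := by
  have hXY := row_orth hdist hexh hniso
  have hYX := mul_eq_one_comm.mp hXY
  set X : Matrix (Fin n) (Fin n) ℂ := Matrix.of fun t i => (V t).character (x i) with hX
  set Y : Matrix (Fin n) (Fin n) ℂ := Matrix.of fun i t =>
    (Fintype.card G : ℂ)⁻¹ * (ksz (x i) * (V t).character (x i)⁻¹) with hY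
  have hd : ∀ t, (Module.finrank ℂ (V t) : ℂ) ≠ 0 := fun t => by
    exact_mod_cast (finrank_pos (V t)).ne'
  have hk : ∀ i, (ksz (x i) : ℂ) ≠ 0 := fun i => by exact_mod_cast (ksz_pos (x i)).ne'
  have hform : ∀ (z : Subalgebra.center ℂ (MonoidAlgebra ℂ G)) t,
      (AlgHom.pi (fun t : Fin n => omgHom (V t))) z t =
      (Module.finrank ℂ (V t) : ℂ)⁻¹ * X.mulVec (fun i => ksz (x i) * z.1.coeff (x i)) t := by
    intro z t
    change omg (V t) z = _
    rw [omg_eq hdist hexh _ _ z.2]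
    congr 1
    refine Finset.sum_congr rfl fun i _ => ?_
    simp only [hX, Matrix.of_apply]
    ring
  constructor
  · rw [injective_iff_map_eq_zero]
    intro z hz
    have h1 : X.mulVec (fun i => ksz (x i) * z.1.coeff (x i)) = 0 := by
      ext t
      have := congrFun hz t
      rw [hform] at this
      simpa [hd t] using this
    have h2 : (fun i => (ksz (x i) : ℂ) * z.1.coeff (x i)) = 0 := by
      rw [← Matrix.one_mulVec (fun i => (ksz (x i) : ℂ) * z.1.coeff (x i)), ← hYX,
        ← Matrix.mulVec_mulVec, h1, Matrix.mulVec_zero]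
    apply Subtype.ext
    rw [eq_sum_classSum hdist hexh z.1 z.2]
    apply Finset.sum_eq_zero
    intro i _
    have := congrFun h2 i
    have h3 : z.1.coeff (x i) = 0 := by simpa [hk i] using this
    rw [h3, zero_smul]
  · intro v
    set u := Y.mulVec (fun t => (Module.finrank ℂ (V t) : ℂ) * v t) with hu
    refine ⟨⟨∑ i, ((ksz (x i) : ℂ)⁻¹ * u i) • classSum G (x i),
      Subalgebra.sum_mem _ fun i _ => Subalgebra.smul_mem _ (classSum_mem _) _⟩, ?_⟩
    ext t
    rw [hform]
    have h1 : (fun i => (ksz (x i) : ℂ) *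
        (∑ i, ((ksz (x i) : ℂ)⁻¹ * u i) • classSum G (x i)).coeff (x i)) = u := by
      ext i
      rw [MonoidAlgebra.coeff_sum, Finsupp.finsetSum_apply, Finset.sum_eq_single i]
      · simp [coeff_cs_pos (IsConj.refl (x i)), hk i]
      · intro j _ hj
        simp [coeff_cs_neg (hdist j i hj)]
      · simp
    rw [h1, hu, Matrix.mulVec_mulVec, hXY, Matrix.one_mulVec, inv_mul_cancel_left₀ (hd t)]

end table

end CT
namespace CT

open CategoryTheory

lemma algHom_pi_eq {n : ℕ} (f : (Fin n → ℂ) →ₐ[ℂ] ℂ) : ∃ t, ∀ v, f v = v t := by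
  have h1 : ∑ t, f (Pi.single t 1) = 1 := by
    rw [← map_sum, Finset.univ_sum_single (fun _ : Fin n => (1 : ℂ))]
    exact map_one f
  obtain ⟨t, _, ht⟩ := Finset.exists_ne_zero_of_sum_ne_zero (by rw [h1]; exact one_ne_zero)
  refine ⟨t, fun v => ?_⟩
  have h2 : v * Pi.single t 1 = v t • (Pi.single t 1 : Fin n → ℂ) := by
    ext s
    by_cases hs : s = t
    · subst hs; simp
    · simp [hs]
  have h3 := congrArg f h2
  rw [map_mul, map_smul, smul_eq_mul] at h3
  exact mul_right_cancel₀ ht h3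

variable {G : Type} [Group G] [Fintype G] {H : Type} [Group H] [Fintype H]

/-- the sum of all group elements -/
noncomputable def nrm (G : Type) [Group G] [Fintype G] : MonoidAlgebra ℂ G :=
  ∑ g : G, MonoidAlgebra.single g 1

lemma coeff_nrm (g : G) : (nrm G).coeff g = 1 := by
  unfold nrm
  rw [MonoidAlgebra.coeff_sum, Finsupp.finsetSum_apply, Finset.sum_eq_single g]
  · simp
  · intro b _ hb
    simp [hb]
  · simp

lemma single_mul_nrm (a : G) : MonoidAlgebra.single a 1 * nrm G = nrm G := by
  ext g
  rw [MonoidAlgebra.coeff_single_mul_apply, coeff_nrm, coeff_nrm, one_mul]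

lemma nrm_mem : nrm G ∈ Subalgebra.center ℂ (MonoidAlgebra ℂ G) := by
  rw [mem_center_iff']
  intro g h _
  rw [coeff_nrm, coeff_nrm]

lemma classSum_mul_nrm (x : G) : classSum G x * nrm G = (ksz x : ℂ) • nrm G := by
  unfold classSum
  rw [← Finset.sum_filter, Finset.sum_mul, Finset.sum_congr rfl (fun a _ => single_mul_nrm a),
    Finset.sum_const, Nat.cast_smul_eq_nsmul]
  rfl

lemma classSum_one : classSum G (1 : G) = 1 := by
  ext g
  by_cases h : g = 1
  · subst h
    rw [coeff_cs_pos (IsConj.refl _)]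
    simp [MonoidAlgebra.one_def]
  · rw [coeff_cs_neg (by simpa using Ne.symm h)]
    simp [MonoidAlgebra.one_def, Ne.symm h]

lemma sum_ksz {n : ℕ} {x : Fin n → G} (hdist : ∀ i j, i ≠ j → ¬ IsConj (x i) (x j))
    (hexh : ∀ g : G, ∃ i, IsConj (x i) g) : (Fintype.card G : ℂ) = ∑ i, (ksz (x i) : ℂ) := by
  have := sum_class hdist hexh (fun _ => 1) (fun _ _ _ => rfl)
  simpa using this

variable {n m : ℕ} {x : Fin n → G} (hdist : ∀ i j, i ≠ j → ¬ IsConj (x i) (x j))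
  (hexh : ∀ g : G, ∃ i, IsConj (x i) g)
  {V : Fin n → FDRep ℂ G} [hs : ∀ t, Simple (V t)]
  (hniso : ∀ l m, l ≠ m → ¬ Nonempty (V l ≅ V m))
  {y : Fin m → H} (hdist' : ∀ i j, i ≠ j → ¬ IsConj (y i) (y j))
  (hexh' : ∀ g : H, ∃ i, IsConj (y i) g)
  {W : Fin m → FDRep ℂ H} [hs' : ∀ t, Simple (W t)]
  (hniso' : ∀ l m, l ≠ m → ¬ Nonempty (W l ≅ W m))

include hdist hexh hniso hdist' hexh' hniso'

theorem forward (σ τ : Fin n ≃ Fin m)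
    (hX : ∀ t i, (V t).character (x i) = (W (σ t)).character (y (τ i))) :
    ∃ φ : Subalgebra.center ℂ (MonoidAlgebra ℂ G) ≃ₐ[ℂ] Subalgebra.center ℂ (MonoidAlgebra ℂ H),
      ∀ i, φ ⟨classSum G (x i), classSum_mem _⟩ = ⟨classSum H (y (τ i)), classSum_mem _⟩ := by
  obtain ⟨i0, hi0⟩ := hexh 1
  have hx0 : x i0 = 1 := by simpa using hi0
  obtain ⟨j0, hj0⟩ := hexh' 1
  have hy0 : y j0 = 1 := by simpa using hj0
  have hd : ∀ t, Module.finrank ℂ (V t) = Module.finrank ℂ (W (σ t)) := by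
    intro t
    apply le_antisymm
    · have h := char_norm_le (W (σ t)) (y (τ i0))
      rw [← hX, hx0, FDRep.char_one, Complex.norm_natCast] at h
      exact_mod_cast h
    · have h := char_norm_le (V t) (x (τ.symm j0))
      rw [hX, Equiv.apply_symm_apply, hy0, FDRep.char_one, Complex.norm_natCast] at h
      exact_mod_cast h
  have hτ : τ i0 = j0 := by
    apply col_inj hdist' hexh' hniso'
    intro s
    obtain ⟨t, rfl⟩ := σ.surjective s
    rw [← hX, hx0, hy0, FDRep.char_one, FDRep.char_one, hd]
  have hS : ∀ i, ∑ j, ∑ t, (V t).character (x i) * (V t).character (x j) =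
      ∑ j, ∑ t, (W t).character (y (τ i)) * (W t).character (y j) := by
    intro i
    rw [← τ.sum_comp]
    refine Finset.sum_congr rfl fun j _ => ?_
    rw [← σ.sum_comp]
    refine Finset.sum_congr rfl fun t _ => ?_
    rw [hX, hX]
  have hcard : (Fintype.card G : ℂ) = Fintype.card H := by
    rw [← ksz_formula hdist hexh hniso i0, ← ksz_formula hdist' hexh' hniso' (τ i0), hS, hx0, hτ,
      hy0, ksz_one, ksz_one]
  have hk : ∀ i, (ksz (x i) : ℂ) = ksz (y (τ i)) := by
    intro i
    have h1 := ksz_formula hdist hexh hniso i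
    have h2 := ksz_formula hdist' hexh' hniso' (τ i)
    rw [hS, hcard, ← h2] at h1
    refine mul_right_cancel₀ ?_ h1
    intro h0
    rw [h0, mul_zero] at h2
    have hc : (Fintype.card H : ℂ) ≠ 0 := by exact_mod_cast Fintype.card_ne_zero
    exact hc h2.symm
  let A := AlgEquiv.ofBijective _ (omg_bij hdist hexh hniso)
  let B := AlgEquiv.ofBijective _ (omg_bij hdist' hexh' hniso')
  let E : (Fin n → ℂ) ≃ₐ[ℂ] (Fin m → ℂ) := AlgEquiv.piCongrLeft ℂ (fun _ : Fin m => ℂ) σ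
  refine ⟨(A.trans E).trans B.symm, fun i => ?_⟩
  rw [AlgEquiv.trans_apply, AlgEquiv.symm_apply_eq]
  ext s
  obtain ⟨t, rfl⟩ := σ.surjective s
  have h1 : (A.trans E) ⟨classSum G (x i), classSum_mem _⟩ (σ t) = omg (V t) (classSum G (x i)) := by
    change (Equiv.piCongrLeft (fun _ : Fin m => ℂ) σ) (A ⟨classSum G (x i), classSum_mem _⟩) (σ t) = _
    rw [Equiv.piCongrLeft_apply_apply]
    rfl
  have h2 : B ⟨classSum H (y (τ i)), classSum_mem _⟩ (σ t) =
    omg (W (σ t)) (classSum H (y (τ i))) := rfl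
  rw [h1, h2, omg_classSum hdist hexh, omg_classSum hdist' hexh', hd, hk, hX]

theorem backward
    (φ : Subalgebra.center ℂ (MonoidAlgebra ℂ G) ≃ₐ[ℂ] Subalgebra.center ℂ (MonoidAlgebra ℂ H))
    (τ : Fin n ≃ Fin m)
    (hφ : ∀ i, φ ⟨classSum G (x i), classSum_mem _⟩ = ⟨classSum H (y (τ i)), classSum_mem _⟩) :
    ∃ σ : Fin n ≃ Fin m,
      ∀ t i, (V t).character (x i) = (W (σ t)).character (y (τ i)) := by
  obtain ⟨i0, hi0⟩ := hexh 1
  have hx0 : x i0 = 1 := by simpa using hi0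
  -- coefficients are transported
  have hcoef : ∀ (z : Subalgebra.center ℂ (MonoidAlgebra ℂ G)) i,
      (φ z).1.coeff (y (τ i)) = z.1.coeff (x i) := by
    intro z i
    have h1 : z = ∑ j, z.1.coeff (x j) •
        (⟨classSum G (x j), classSum_mem _⟩ : Subalgebra.center ℂ (MonoidAlgebra ℂ G)) := by
      apply Subtype.ext
      have := eq_sum_classSum hdist hexh z.1 z.2
      simpa using this
    have h2 : (φ z).1 = ∑ j, z.1.coeff (x j) • classSum H (y (τ j)) := by
      conv_lhs => rw [h1]
      rw [map_sum]
      simp only [map_smul, hφ]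
      simp
    rw [h2, MonoidAlgebra.coeff_sum, Finsupp.finsetSum_apply, Finset.sum_eq_single i]
    · simp [coeff_cs_pos (IsConj.refl (y (τ i)))]
    · intro j _ hj
      simp [coeff_cs_neg (hdist' (τ j) (τ i) (fun h => hj (τ.injective h)))]
    · simp
  have hy0 : y (τ i0) = 1 := by
    have h1 := hφ i0
    have h2 : (⟨classSum G (x i0), classSum_mem _⟩ : Subalgebra.center ℂ (MonoidAlgebra ℂ G)) = 1 := by
      apply Subtype.ext
      simp only [hx0, classSum_one, OneMemClass.coe_one]
    rw [h2, map_one] at h1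
    have h3 : (1 : MonoidAlgebra ℂ H).coeff (y (τ i0)) = 1 := by
      have h4 := congrArg Subtype.val h1
      simp only [OneMemClass.coe_one] at h4
      rw [h4, coeff_cs_pos (IsConj.refl _)]
    by_contra hne
    rw [MonoidAlgebra.one_def] at h3
    simp [hne] at h3
  have hnrm : φ ⟨nrm G, nrm_mem⟩ = ⟨nrm H, nrm_mem⟩ := by
    apply Subtype.ext
    change (φ ⟨nrm G, nrm_mem⟩).1 = nrm H
    rw [eq_sum_classSum hdist' hexh' _ (φ ⟨nrm G, nrm_mem⟩).2,
      eq_sum_classSum hdist' hexh' (nrm H) nrm_mem]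
    refine Finset.sum_congr rfl fun j _ => ?_
    obtain ⟨i, rfl⟩ := τ.surjective j
    rw [hcoef, coeff_nrm, coeff_nrm]
  have hk : ∀ i, (ksz (x i) : ℂ) = ksz (y (τ i)) := by
    intro i
    have h1 : (⟨classSum G (x i), classSum_mem _⟩ : Subalgebra.center ℂ (MonoidAlgebra ℂ G)) *
        ⟨nrm G, nrm_mem⟩ = (ksz (x i) : ℂ) • ⟨nrm G, nrm_mem⟩ :=
      Subtype.ext (classSum_mul_nrm (x i))
    have h2 := congrArg φ h1
    rw [map_mul, map_smul, hφ, hnrm] at h2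
    have h3 := congrArg Subtype.val h2
    have h4 : classSum H (y (τ i)) * nrm H = (ksz (x i) : ℂ) • nrm H := h3
    rw [classSum_mul_nrm] at h4
    have h5 := congrArg (fun w => w.coeff 1) h4
    simpa [coeff_nrm] using h5.symm
  have hcard : (Fintype.card G : ℂ) = Fintype.card H := by
    rw [sum_ksz hdist hexh, sum_ksz hdist' hexh', ← τ.sum_comp]
    exact Finset.sum_congr rfl fun i _ => hk i
  let A := AlgEquiv.ofBijective _ (omg_bij hdist hexh hniso)
  let B := AlgEquiv.ofBijective _ (omg_bij hdist' hexh' hniso')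
  let ψ : (Fin n → ℂ) ≃ₐ[ℂ] (Fin m → ℂ) := (A.symm.trans φ).trans B
  have hA : ∀ z t, A z t = omg (V t) z.1 := fun _ _ => rfl
  have hB : ∀ z t, B z t = omg (W t) z.1 := fun _ _ => rfl
  have hex : ∀ s, ∃ t, ∀ v, ψ v s = v t := fun s =>
    algHom_pi_eq ((Pi.evalAlgHom ℂ (fun _ : Fin m => ℂ) s).comp ψ.toAlgHom)
  choose r hr using hex
  have hrinj : Function.Injective r := by
    intro a b hab
    by_contra hne
    obtain ⟨v, hv⟩ := ψ.surjective (Pi.single a 1)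
    have h1 := hr a v
    have h2 := hr b v
    rw [hab, ← h2, hv] at h1
    simp [Ne.symm hne] at h1
  have hrbij : Function.Bijective r := by
    rw [Fintype.bijective_iff_injective_and_card]
    exact ⟨hrinj, Fintype.card_congr τ.symm⟩
  let σ := (Equiv.ofBijective r hrbij).symm
  have hrσ : ∀ t, r (σ t) = t := fun t => (Equiv.ofBijective r hrbij).apply_symm_apply t
  have hω : ∀ z t, omg (W (σ t)) (φ z).1 = omg (V t) z.1 := by
    intro z t
    have := hr (σ t) (A z)
    rw [hrσ, hA] at this
    rw [← this, ← hB]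
    simp [ψ]
  have hd : ∀ t, (Module.finrank ℂ (V t) : ℂ) = Module.finrank ℂ (W (σ t)) := by
    intro t
    obtain ⟨z, hz⟩ := A.surjective (Pi.single t 1)
    have hz' : ∀ s, omg (V s) z.1 = (Pi.single t 1 : Fin n → ℂ) s := fun s => by rw [← hz, hA]
    have h1 := coeff_one_formula hdist hexh hniso z.1 z.2
    have h2 := coeff_one_formula hdist' hexh' hniso' (φ z).1 (φ z).2
    rw [← hy0, hcoef, hx0, ← hcard, h1, ← σ.sum_comp] at h2
    simp_rw [hω, hz'] at h2
    rw [Finset.sum_eq_single t, Finset.sum_eq_single t] at h2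
    · simp only [Pi.single_eq_same, mul_one] at h2
      have h3 : (Module.finrank ℂ (V t)) ^ 2 = (Module.finrank ℂ (W (σ t))) ^ 2 := by
        exact_mod_cast h2
      exact_mod_cast Nat.pow_left_injective two_ne_zero h3
    · intro b _ hb; simp [hb]
    · simp
    · intro b _ hb; simp [hb]
    · simp
  refine ⟨σ, fun t i => ?_⟩
  have h1 := hω ⟨classSum G (x i), classSum_mem _⟩ t
  rw [hφ] at h1
  simp only at h1
  rw [omg_classSum hdist hexh, omg_classSum hdist' hexh', hd, hk] at h1
  have hd0 : (Module.finrank ℂ (W (σ t)) : ℂ)⁻¹ ≠ 0 :=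
    inv_ne_zero (by exact_mod_cast (finrank_pos (W (σ t))).ne')
  have hk0 : (ksz (y (τ i)) : ℂ) ≠ 0 := by exact_mod_cast (ksz_pos _).ne'
  exact (mul_left_cancel₀ hk0 (mul_left_cancel₀ hd0 h1)).symm

end CT

/-- two finite groups have the same character table (up to relabeling of
irreducible characters and of conjugacy classes) iff there is an algebra isomorphism of
the centers of their complex group algebras carrying class sums bijectively to class
sums. -/
theorem same_character_table_iff_center_iso
    (G H : Type) [Group G] [Fintype G] [Group H] [Fintype H]
    {nG nH : ℕ}
    (xG : Fin nG → G) (hGdist : ∀ i j, i ≠ j → ¬ IsConj (xG i) (xG j))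
    (hGexh : ∀ g : G, ∃ i, IsConj (xG i) g)
    (xH : Fin nH → H) (hHdist : ∀ i j, i ≠ j → ¬ IsConj (xH i) (xH j))
    (hHexh : ∀ h : H, ∃ i, IsConj (xH i) h)
    (VG : Fin nG → FDRep ℂ G)
    (hGsimple : ∀ l, CategoryTheory.Simple (VG l))
    (hGnoniso : ∀ l m, l ≠ m → ¬ Nonempty (VG l ≅ VG m))
    (hGcomplete : ∀ W : FDRep ℂ G, CategoryTheory.Simple W → ∃ l, Nonempty (W ≅ VG l))
    (VH : Fin nH → FDRep ℂ H)
    (hHsimple : ∀ l, CategoryTheory.Simple (VH l))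
    (hHnoniso : ∀ l m, l ≠ m → ¬ Nonempty (VH l ≅ VH m))
    (hHcomplete : ∀ W : FDRep ℂ H, CategoryTheory.Simple W → ∃ l, Nonempty (W ≅ VH l))
    (hcG : ∀ i, classSum G (xG i) ∈ Subalgebra.center ℂ (MonoidAlgebra ℂ G)) :
    (∃ (σ : Fin nG ≃ Fin nH) (τ : Fin nG ≃ Fin nH),
      ∀ t L, (VG t).character (xG L) = (VH (σ t)).character (xH (τ L))) ↔
    (∃ (φ : Subalgebra.center ℂ (MonoidAlgebra ℂ G) ≃ₐ[ℂ]
            Subalgebra.center ℂ (MonoidAlgebra ℂ H)) (τ : Fin nG ≃ Fin nH),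
      ∀ i, (φ ⟨classSum G (xG i), hcG i⟩ : MonoidAlgebra ℂ H) = classSum H (xH (τ i))) := by
  have hs := hGsimple
  have hs' := hHsimple
  constructor
  · rintro ⟨σ, τ, h⟩
    obtain ⟨φ, hφ⟩ := CT.forward hGdist hGexh hGnoniso hHdist hHexh hHnoniso σ τ h
    exact ⟨φ, τ, fun i => congrArg Subtype.val (hφ i)⟩
  · rintro ⟨φ, τ, h⟩
    obtain ⟨σ, hσ⟩ := CT.backward hGdist hGexh hGnoniso hHdist hHexh hHnoniso φ τ
      (fun i => Subtype.ext (h i))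
    exact ⟨σ, τ, hσ⟩
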